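/- arXiv:2405.01854 — 2 statements merged into one kernel-verified Lean document; each statement's English description precedes it below -/
import Mathlib

section
/- Let π ∈ Sₙ and let πᵢ = min(π₁,…,π_{𝔅(π)−1}) where 𝔅(π) is the valley-boundary of π. If πᵢ ≤ ⌊(n−1)/2⌋ (i.e., πᵢ is small), then the value πᵢ lies in the valley-region of s_{123,132}(π). -/
open scoped Classical

/-- `π` is a permutation of `{1,…,n}` presented as a list. -/
def IsPermOf (n : ℕ) (π : List ℕ) : Prop :=
  π.Perm ((List.range n).map (· + 1))

/-- 1-indexed entry of a list. -/
def ent (π : List ℕ) (i : ℕ) : ℕ := π.getD (i - 1) 0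

/-- `a` and `b` are order-isomorphic (same length, same relative order). -/
def isoBool (a b : List ℕ) : Bool :=
  (a.length == b.length) &&
    (List.range a.length).all fun i =>
      (List.range a.length).all fun j =>
        !(decide (i < j)) ||
          (decide (a.getD i 0 < a.getD j 0) == decide (b.getD i 0 < b.getD j 0))

/-- `l` contains a subsequence order-isomorphic to the pattern `p`. -/
def containsPat (l p : List ℕ) : Bool :=
  l.sublists.any fun t => isoBool t p

/-- One full run of the right-greedy pattern-avoiding stack machine.
`T` is the list of forbidden patterns; the stack is read top-to-bottom
(head = top).  Push is preferred whenever the resulting stack avoids all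
patterns in `T`; otherwise the top of the stack is popped to the output.
At the end the stack is emptied onto the output. -/
def sortRun (T : List (List ℕ)) : List ℕ → List ℕ → List ℕ → List ℕ
  | [], stack, out => out ++ stack
  | x :: rest, stack, out =>
    if T.all (fun p => !containsPat (x :: stack) p) then
      sortRun T rest (x :: stack) out
    else
      match stack with
      | [] => sortRun T rest [x] out
      | y :: st => sortRun T (x :: rest) st (out ++ [y])
termination_by inp stack _ => 2 * inp.length + stack.length
decreasing_by all_goals (simp only [List.length_cons]; omega)

/-- The generalized stack-sorting map `s_T`. -/
def sortT (T : List (List ℕ)) (π : List ℕ) : List ℕ := sortRun T π [] []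

/-- The stack-sorting map `s_{123,132}`. -/
def s132 (π : List ℕ) : List ℕ := sortT [[1, 2, 3], [1, 3, 2]] π

/-- `π_i` is a left-to-right minimum of `π` (1-indexed). -/
def IsLtrMin (π : List ℕ) (i : ℕ) : Prop :=
  1 ≤ i ∧ i ≤ π.length ∧ ∀ m, 1 ≤ m → m ≤ i → ent π i ≤ ent π m

/-- `π_i` is a valley of `π`. -/
def IsValley (π : List ℕ) (i : ℕ) : Prop :=
  IsLtrMin π i ∧ (i + 1 ≤ π.length → ¬ IsLtrMin π (i + 1)) ∧
    (i + 2 ≤ π.length → IsLtrMin π (i + 2))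

/-- Positions `i, i+1, …, i+j` of `π` form a valley-block: `π_{i+j}` is a
valley and `π_i > ⋯ > π_{i+j}` are the `j+1` smallest entries among
`π_1,…,π_{i+j}`. -/
def IsValleyBlock (π : List ℕ) (i j : ℕ) : Prop :=
  1 ≤ i ∧ i + j ≤ π.length ∧ IsValley π (i + j) ∧
    (∀ k, i ≤ k → k < i + j → ent π (k + 1) < ent π k) ∧
    (∀ m, 1 ≤ m → m < i → ent π i < ent π m)

/-- Auxiliary (fuelled) predicate: the positions `i, i+1, …, π.length` of `π`
decompose as an alternation `v̄₁ a₁ v̄₂ a₂ ⋯ v̄_j a_j` of valley-blocks and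
single entries. -/
def AltFromAux (π : List ℕ) : ℕ → ℕ → Prop
  | 0, i => i = π.length + 1
  | fuel + 1, i => i = π.length + 1 ∨
      ∃ j, IsValleyBlock π i j ∧ AltFromAux π fuel (i + j + 2)

/-- The suffix of `π` starting at position `i` is a (nonempty) alternation of
valley-blocks and single entries. -/
def AltDecomp (π : List ℕ) (i : ℕ) : Prop :=
  i ≤ π.length ∧ AltFromAux π (π.length + 1) i

/-- The valley-boundary `𝔅(π)`: the smallest index `i` such that the suffix
`π_i,…,π_n` is an alternation of valley-blocks and single entries, and
`π.length` if no such index exists. -/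
noncomputable def vBoundary (π : List ℕ) : ℕ :=
  if _h : ∃ i, 1 ≤ i ∧ AltDecomp π i then sInf {i | 1 ≤ i ∧ AltDecomp π i}
  else π.length

/-- The value `x` appears in the valley-region `π_{𝔅(π)},…,π_n` of `π`. -/
def InValleyRegion (π : List ℕ) (x : ℕ) : Prop :=
  ∃ i, vBoundary π ≤ i ∧ i ≤ π.length ∧ ent π i = x

/-- `π` is half-decreasing: `π_{n-1}, π_{n-3}, …` (⌊(n−1)/2⌋ entries) is the
identity `1, 2, …, ⌊(n−1)/2⌋`. -/
def HalfDecreasing (π : List ℕ) : Prop :=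
  ∀ k, 1 ≤ k → k ≤ (π.length - 1) / 2 → ent π (π.length + 1 - 2 * k) = k

/-- `π` is periodic under `s_{123,132}`. -/
def PeriodicS (π : List ℕ) : Prop := ∃ k, 1 ≤ k ∧ s132^[k] π = π

def Good (l : List ℕ) : Prop := ∀ a b c, List.Sublist [a, b, c] l → ¬ (a < b ∧ a < c)

theorem iso_aux (a b c : ℕ) :
    (isoBool [a, b, c] [1, 2, 3] = true ∨ isoBool [a, b, c] [1, 3, 2] = true) ↔ (a < b ∧ a < c) := by
  have h3 : List.range 3 = [0, 1, 2] := rfl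
  simp [isoBool, h3]
  omega

theorem good_iff (l : List ℕ) :
    ([[1, 2, 3], [1, 3, 2]].all (fun p => !containsPat l p)) = true ↔ Good l := by
  constructor
  · intro h a b c hs hlt
    simp [containsPat] at h
    rcases (iso_aux a b c).2 hlt with h' | h'
    · rw [h.1 _ hs] at h'; cases h'
    · rw [h.2 _ hs] at h'; cases h'
  · intro h
    have key : ∀ t, List.Sublist t l →
        ¬ (isoBool t [1, 2, 3] = true ∨ isoBool t [1, 3, 2] = true) := by
      intro t ht hc
      have hl : t.length = 3 := by
        rcases hc with hc | hc <;> (simp [isoBool] at hc; exact hc.1)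
      obtain ⟨a, b, c, rfl⟩ := List.length_eq_three.1 hl
      exact h a b c ht ((iso_aux a b c).1 hc)
    simp [containsPat]
    constructor
    · intro t ht
      have := key t ht
      grind
    · intro t ht
      have := key t ht
      grind

theorem good_two (x b : ℕ) : Good [x, b] := by
  intro a b c hs
  have := hs.length_le
  simp at this

theorem good_three (x m b : ℕ) (h : m < x) : Good [x, m, b] := by
  intro p q r hs
  have := hs.eq_of_length (by simp)
  simp at this
  omega

theorem run_push (x : ℕ) (rest st out : List ℕ) (h : Good (x :: st)) :
    sortRun [[1, 2, 3], [1, 3, 2]] (x :: rest) st out =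
      sortRun [[1, 2, 3], [1, 3, 2]] rest (x :: st) out := by
  rw [sortRun.eq_def]
  simp only
  rw [if_pos ((good_iff _).2 h)]

theorem run_pop (x y : ℕ) (rest st out : List ℕ) (h : ¬ Good (x :: y :: st)) :
    sortRun [[1, 2, 3], [1, 3, 2]] (x :: rest) (y :: st) out =
      sortRun [[1, 2, 3], [1, 3, 2]] (x :: rest) st (out ++ [y]) := by
  rw [sortRun.eq_def]
  simp only
  rw [if_neg (fun hh => h ((good_iff _).1 hh))]

theorem run_nil (st out : List ℕ) :
    sortRun [[1, 2, 3], [1, 3, 2]] [] st out = out ++ st := by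
  rw [sortRun.eq_def]

theorem run_step (x : ℕ) (rest B : List ℕ) (hB : Good (x :: B)) (C : List ℕ) :
    ∀ out, ∃ D C', C = D ++ C' ∧ Good (x :: (C' ++ B)) ∧
      sortRun [[1, 2, 3], [1, 3, 2]] (x :: rest) (C ++ B) out =
        sortRun [[1, 2, 3], [1, 3, 2]] rest (x :: (C' ++ B)) (out ++ D) := by
  induction C with
  | nil => exact fun out => ⟨[], [], rfl, hB, by simpa using run_push x rest B out hB⟩
  | cons y C ih =>
    intro out
    by_cases h : Good (x :: (y :: C ++ B))
    · exact ⟨[], y :: C, rfl, h, by simpa using run_push x rest _ out h⟩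
    · obtain ⟨D, C', h1, h2, h3⟩ := ih (out ++ [y])
      refine ⟨y :: D, C', by simp [h1], h2, ?_⟩
      rw [List.cons_append, run_pop x y rest (C ++ B) out h, h3]
      simp

theorem run_multi (rest B : List ℕ) (W : List ℕ) :
    ∀ C out, (∀ x ∈ W, Good (x :: B)) → ∃ C' out', (out' ++ C').Perm (out ++ C ++ W) ∧
      sortRun [[1, 2, 3], [1, 3, 2]] (W ++ rest) (C ++ B) out =
        sortRun [[1, 2, 3], [1, 3, 2]] rest (C' ++ B) out' := by
  induction W with
  | nil => exact fun C out _ => ⟨C, out, by simp, rfl⟩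
  | cons x W ih =>
    intro C out hW
    obtain ⟨D, C', h1, h2, h3⟩ := run_step x (W ++ rest) B (hW x (by simp)) C out
    obtain ⟨C'', out'', h4, h5⟩ := ih (x :: C') (out ++ D) (fun y hy => hW y (by simp [hy]))
    refine ⟨C'', out'', h4.trans ?_, ?_⟩
    · subst h1
      rw [List.perm_iff_count]
      intro a
      simp [List.count_cons]
      omega
    · rw [List.cons_append, h3, ← h5]; simp

theorem run_newmin (x b : ℕ) (rest C out : List ℕ) (hC : ∀ c ∈ C, x < c) (hb : x < b) :
    sortRun [[1, 2, 3], [1, 3, 2]] (x :: rest) (C ++ [b]) out =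
      sortRun [[1, 2, 3], [1, 3, 2]] rest [x, b] (out ++ C) := by
  obtain ⟨D, C', h1, h2, h3⟩ := run_step x rest [b] (good_two x b) C out
  cases C' with
  | nil => rw [h3, h1]; simp
  | cons c C' =>
    exfalso
    refine h2 x c b ?_ ⟨hC c (by simp [h1]), hb⟩
    simp

inductive Blk : ℕ → List ℕ → Prop
  | nil (x : ℕ) : Blk x []
  | one (x m : ℕ) (R : List ℕ) : m < x → Blk m R → Blk x (m :: R)
  | two (x m a : ℕ) (R : List ℕ) : m < x → m < a → a ≠ x → Blk m R → Blk x (m :: a :: R)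

inductive Blk' : ℕ → List ℕ → Prop
  | nil (x : ℕ) : Blk' x []
  | one (x m : ℕ) (R : List ℕ) : m < x → Blk' m R → Blk' x (m :: R)
  | two (x m a : ℕ) (R : List ℕ) : m < x → m < a → a ≠ x → Blk' m R → Blk' x (a :: m :: R)

theorem run_blk (b x : ℕ) (R : List ℕ) (h : Blk x R) : ∀ C out, x < b → (∀ c ∈ C, x < c) →
    ∃ R', Blk' x R' ∧ sortRun [[1, 2, 3], [1, 3, 2]] R (C ++ [x, b]) out =
      out ++ C ++ x :: R' ++ [b] := by
  induction h with
  | nil x => exact fun C out _ _ => ⟨[], .nil x, by rw [run_nil]; simp⟩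
  | one x m R h1 h2 ih =>
    intro C out hb hC
    obtain ⟨R', h3, h4⟩ := ih [] (out ++ (C ++ [x])) (by omega) (by simp)
    refine ⟨m :: R', .one _ _ _ h1 h3, ?_⟩
    have := run_newmin m b R (C ++ [x]) out
      (by intro c hc; simp at hc; rcases hc with hc | rfl; exacts [h1.trans (hC c hc), h1]) (by omega)
    simp at this h4 ⊢
    rw [this, h4]
  | two x m a R h1 ha hax h2 ih =>
    intro C out hb hC
    obtain ⟨R', h3, h4⟩ := ih [a] (out ++ (C ++ [x])) (by omega) (by simpa using ha)
    refine ⟨a :: m :: R', .two _ _ _ _ h1 ha hax h3, ?_⟩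
    have := run_newmin m b (a :: R) (C ++ [x]) out
      (by intro c hc; simp at hc; rcases hc with hc | rfl; exacts [h1.trans (hC c hc), h1]) (by omega)
    have h5 := run_push a R [m, b] (out ++ (C ++ [x])) (good_three a m b ha)
    simp at this h4 h5 ⊢
    rw [this, h5, h4]

/-- structure of the image -/
theorem s_struct (b x : ℕ) (A w R : List ℕ) (hA : ∀ c ∈ A, x < c) (hb : x < b)
    (hw : ∀ c ∈ w, x < c) (hR : Blk x R) :
    ∃ F R', (∀ c ∈ F, x < c) ∧ Blk' x R' ∧ s132 (b :: A ++ x :: w ++ R) = F ++ x :: R' ++ [b] := by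
  have h0 := run_push b (A ++ x :: w ++ R) [] [] (by
    intro p q r hs; have := hs.length_le; simp at this)
  obtain ⟨C1, o1, p1, e1⟩ := run_multi (x :: (w ++ R)) [b] A [] [] (fun y _ => good_two y b)
  have hC1 : ∀ c ∈ o1 ++ C1, x < c := fun c hc => hA c (by simpa using p1.subset hc)
  have e2 := run_newmin x b (w ++ R) C1 o1 (fun c hc => hC1 c (by simp [hc])) hb
  obtain ⟨C2, o2, p2, e3⟩ := run_multi R [x, b] w [] (o1 ++ C1) (fun y hy => good_three y x b (hw y hy))
  have hC2 : ∀ c ∈ o2 ++ C2, x < c := by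
    intro c hc
    have := p2.subset hc
    simp only [List.append_nil, List.mem_append] at this hC1
    rcases this with h | h
    exacts [hC1 c h, hw c h]
  obtain ⟨R', h3, e4⟩ := run_blk b x R hR C2 o2 hb (fun c hc => hC2 c (by simp [hc]))
  refine ⟨o2 ++ C2, R', hC2, h3, ?_⟩
  unfold s132 sortT
  simp at h0 e1 e2 e3 e4 ⊢
  rw [h0, e1, e2, e3, e4]

theorem s_last (x : ℕ) (W : List ℕ) : ∃ F, s132 (x :: W) = F ++ [x] := by
  have h0 := run_push x W [] [] (by
    intro p q r hs; have := hs.length_le; simp at this)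
  obtain ⟨C1, o1, p1, e1⟩ := run_multi [] [x] W [] [] (fun y _ => good_two y x)
  refine ⟨o1 ++ C1, ?_⟩
  unfold s132 sortT
  rw [run_nil] at e1
  simp at h0 e1 ⊢
  rw [h0, e1]

theorem ent_app (F R : List ℕ) (x : ℕ) : ent (F ++ x :: R) (F.length + 1) = x := by
  simp [ent]

theorem ent_mem_left (F R : List ℕ) (m : ℕ) (h1 : 1 ≤ m) (h : m ≤ F.length) :
    ent (F ++ R) m ∈ F := by
  have : m - 1 < F.length := by omega
  simp [ent, List.getElem?_append, this]

theorem ltrmin_app (F R : List ℕ) (x : ℕ) (hF : ∀ c ∈ F, x < c) :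
    IsLtrMin (F ++ x :: R) (F.length + 1) := by
  refine ⟨by omega, by simp, ?_⟩
  intro m h1 h2
  rcases Nat.lt_or_ge F.length m with h | h
  · have : m = F.length + 1 := by omega
    subst this; rfl
  · rw [ent_app]
    exact (hF _ (ent_mem_left F _ m h1 h)).le

theorem alt_cons (L : List ℕ) (fuel i : ℕ) (h1 : 1 ≤ i) (hi : i + 1 ≤ L.length)
    (hs : ∀ m, 1 ≤ m → m < i → ent L i < ent L m) (hlt : ent L (i + 1) < ent L i)
    (h : AltFromAux L (fuel + 1) (i + 1)) : AltFromAux L (fuel + 1) i := by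
  rcases h with h | ⟨j, ⟨b1, b2, b3, b4, b5⟩, h⟩
  · omega
  · refine Or.inr ⟨j + 1, ⟨h1, by omega, ?_, ?_, hs⟩, ?_⟩
    · rwa [show i + (j + 1) = i + 1 + j by omega]
    · intro k hk1 hk2
      rcases Nat.eq_or_lt_of_le hk1 with rfl | hk
      · exact hlt
      · exact b4 k hk (by omega)
    · rwa [show i + (j + 1) + 2 = i + 1 + j + 2 by omega]

theorem alt_cons_app (F R : List ℕ) (x m fuel : ℕ) (hF : ∀ c ∈ F, x < c) (hm : m < x)
    (h : AltFromAux (F ++ x :: m :: R) (fuel + 1) (F.length + 2)) :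
    AltFromAux (F ++ x :: m :: R) (fuel + 1) (F.length + 1) := by
  have e2 : ent (F ++ x :: m :: R) (F.length + 1 + 1) = m := by
    have := ent_app (F ++ [x]) R m
    simpa using this
  refine alt_cons _ _ _ (by omega) (by simp) ?_ ?_ h
  · intro k h1 h2
    rw [ent_app]
    exact hF _ (ent_mem_left F _ k h1 (by omega))
  · rw [ent_app, e2]; exact hm

theorem alt_single (F R : List ℕ) (x a fuel : ℕ) (hF : ∀ c ∈ F, x < c) (ha : x < a)
    (hR : ∀ m R', R = m :: R' → IsLtrMin (F ++ x :: a :: R) (F.length + 3))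
    (h : AltFromAux (F ++ x :: a :: R) fuel (F.length + 3)) :
    AltFromAux (F ++ x :: a :: R) (fuel + 1) (F.length + 1) := by
  have e2 : ent (F ++ x :: a :: R) (F.length + 1 + 1) = a := by
    have := ent_app (F ++ [x]) R a
    simpa using this
  refine Or.inr ⟨0, ⟨by omega, by simp, ⟨ltrmin_app _ _ _ hF, ?_, ?_⟩, by omega, ?_⟩, h⟩
  · rintro - ⟨-, -, hh⟩
    have := hh (F.length + 1) (by omega) (by omega)
    simp only [Nat.add_zero] at this
    rw [ent_app, e2] at this
    omega
  · intro hl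
    cases R with
    | nil => simp at hl
    | cons m R' => exact hR m R' rfl
  · intro k h1 h2
    rw [ent_app]
    exact hF _ (ent_mem_left F _ k h1 (by omega))

theorem alt_main (b x : ℕ) (R : List ℕ) (h : Blk' x R) : ∀ F fuel, x < b → (∀ c ∈ F, x < c) →
    R.length + 2 ≤ fuel → AltFromAux (F ++ x :: (R ++ [b])) fuel (F.length + 1) := by
  induction h with
  | nil x =>
    intro F fuel hb hF hfu
    obtain ⟨f, rfl⟩ : ∃ f, fuel = f + 1 + 1 := ⟨fuel - 2, by simp at hfu; omega⟩
    refine alt_single F [] x b (f + 1) hF hb (by simp) ?_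
    left; simp
  | one x m R h1 h2 ih =>
    intro F fuel hb hF hfu
    obtain ⟨f, rfl⟩ : ∃ f, fuel = f + 1 := ⟨fuel - 1, by omega⟩
    refine alt_cons_app F (R ++ [b]) x m f hF h1 ?_
    have := ih (F ++ [x]) (f + 1) (by omega) ?_ (by simp at hfu; omega)
    · simpa using this
    · intro c hc; simp at hc; rcases hc with hc | rfl; exacts [h1.trans (hF c hc), h1]
  | two x m a R h1 ha hax h2 ih =>
    intro F fuel hb hF hfu
    simp at hfu
    obtain ⟨f, rfl⟩ : ∃ f, fuel = f + 1 := ⟨fuel - 1, by omega⟩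
    have hF2 : ∀ c ∈ F ++ [x, a], m < c := by
      intro c hc; simp at hc
      rcases hc with hc | rfl | rfl
      exacts [h1.trans (hF c hc), h1, ha]
    rcases lt_or_gt_of_ne hax with hlt | hgt
    · refine alt_cons_app F (m :: (R ++ [b])) x a f hF hlt ?_
      have h3 := alt_cons_app (F ++ [x]) (R ++ [b]) a m f ?_ ha ?_
      · simpa using h3
      · intro c hc; simp at hc; rcases hc with hc | rfl; exacts [hlt.trans (hF c hc), hlt]
      · have := ih (F ++ [x, a]) (f + 1) (by omega) hF2 (by omega)
        simpa using this
    · refine alt_single F (m :: (R ++ [b])) x a f hF hgt ?_ ?_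
      · intro _ _ _
        have := ltrmin_app (F ++ [x, a]) (R ++ [b]) m hF2
        simpa using this
      · have := ih (F ++ [x, a]) f (by omega) hF2 (by omega)
        simpa using this

theorem vB_le (L : List ℕ) (i : ℕ) (h1 : 1 ≤ i) (h : AltDecomp L i) : vBoundary L ≤ i := by
  unfold vBoundary
  rw [dif_pos ⟨i, h1, h⟩]
  exact Nat.sInf_le ⟨h1, h⟩

theorem vB_spec (L : List ℕ) :
    (1 ≤ vBoundary L ∧ AltDecomp L (vBoundary L)) ∨ vBoundary L = L.length := by
  unfold vBoundary
  split_ifs with h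
  · exact Or.inl (Nat.sInf_mem h)
  · exact Or.inr rfl

theorem vB_le_length (L : List ℕ) : vBoundary L ≤ L.length := by
  rcases vB_spec L with h | h
  · exact h.2.1
  · exact h.le

theorem region_last (F : List ℕ) (x : ℕ) : InValleyRegion (F ++ [x]) x :=
  ⟨F.length + 1, by simpa using vB_le_length (F ++ [x]), by simp, ent_app F [] x⟩

theorem region_main (b x : ℕ) (F R : List ℕ) (h : Blk' x R) (hb : x < b) (hF : ∀ c ∈ F, x < c) :
    InValleyRegion (F ++ x :: R ++ [b]) x := by
  refine ⟨F.length + 1, vB_le _ _ (by omega) ⟨by simp, ?_⟩, by simp, ?_⟩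
  · have := alt_main b x R h F ((F ++ x :: R ++ [b]).length + 1) hb hF (by simp; omega)
    simpa using this
  · rw [List.append_assoc, List.cons_append]; exact ent_app _ _ _

theorem drop_ent (π : List ℕ) (p : ℕ) (h1 : 1 ≤ p) (h : p ≤ π.length) :
    π.drop (p - 1) = ent π p :: π.drop p := by
  rw [List.drop_eq_getElem_cons (by omega)]
  rw [show p - 1 + 1 = p by omega]
  simp [ent, List.getElem?_eq_getElem (show p - 1 < π.length by omega)]

theorem ent_inj (π : List ℕ) (hn : π.Nodup) (p q : ℕ) (h1 : 1 ≤ p) (h2 : p ≤ π.length)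
    (h3 : 1 ≤ q) (h4 : q ≤ π.length) (h : ent π p = ent π q) : p = q := by
  have a1 : p - 1 < π.length := by omega
  have a2 : q - 1 < π.length := by omega
  simp [ent, List.getElem?_eq_getElem a1, List.getElem?_eq_getElem a2] at h
  have := (hn.getElem_inj_iff).1 h
  omega

theorem blk_inner (π : List ℕ) (hn : π.Nodup) (j : ℕ) : ∀ p x, 1 ≤ p → p + j + 1 ≤ π.length →
    ent π p < x → (∀ k, p ≤ k → k < p + j → ent π (k + 1) < ent π k) →
    ent π (p + j) < ent π (p + j + 1) → (∀ k, p ≤ k → k ≤ π.length → ent π k ≠ x) →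
    Blk (ent π (p + j)) (π.drop (p + j + 1)) → Blk x (π.drop (p - 1)) := by
  induction j with
  | zero =>
    intro p x h1 h2 h3 h4 h5 h6 h7
    rw [drop_ent π p h1 (by omega)]
    have := drop_ent π (p + 1) (by omega) (by omega)
    simp only [Nat.add_sub_cancel] at this
    rw [this]
    exact .two _ _ _ _ h3 h5 (h6 _ (by omega) (by omega)) h7
  | succ j ih =>
    intro p x h1 h2 h3 h4 h5 h6 h7
    rw [drop_ent π p h1 (by omega)]
    refine .one _ _ _ h3 ?_
    rw [show p + (j + 1) = p + 1 + j by omega] at *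
    have := ih (p + 1) (ent π p) (by omega) (by omega) (h4 p (by omega) (by omega))
      (fun k hk1 hk2 => h4 k (by omega) (by omega)) h5 ?_ h7
    · simpa using this
    · intro k hk1 hk2 he
      have := ent_inj π hn k p (by omega) hk2 h1 (by omega) he
      omega

theorem alt_le (π : List ℕ) (fuel p : ℕ) (h : AltFromAux π fuel p) : p ≤ π.length + 1 := by
  cases fuel with
  | zero => exact Nat.le_of_eq h
  | succ f =>
    rcases h with h | ⟨j, h, -⟩
    · omega
    · have := h.2.1; omega

theorem blk_of_alt (π : List ℕ) (hn : π.Nodup) (fuel : ℕ) : ∀ p i, AltFromAux π fuel p →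
    1 ≤ i → i < p → Blk (ent π i) (π.drop (p - 1)) := by
  induction fuel with
  | zero =>
    intro p i h h1 h2
    have h : p = π.length + 1 := h
    rw [List.drop_eq_nil_of_le (by omega)]
    exact .nil _
  | succ f ih =>
    intro p i h h1 h2
    rcases h with h | ⟨j, ⟨b1, b2, ⟨b3, b3', -⟩, b4, b5⟩, h⟩
    · rw [List.drop_eq_nil_of_le (by omega)]
      exact .nil _
    · have hl := alt_le _ _ _ h
      refine blk_inner π hn j p _ (by omega) (by omega) (b5 i h1 h2) b4 ?_ ?_ ?_
      · by_contra hc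
        apply b3' (by omega)
        refine ⟨by omega, by omega, ?_⟩
        intro m hm1 hm2
        rcases Nat.eq_or_lt_of_le hm2 with rfl | hm
        · rfl
        · have := b3.2.2 m hm1 (by omega)
          omega
      · intro k hk1 hk2 he
        have := ent_inj π hn k i (by omega) hk2 h1 (by omega) he
        omega
      · exact ih _ (p + j) h (by omega) (by omega)

theorem decomp (π : List ℕ) (hn : π.Nodup) (i q : ℕ) (h1 : 1 ≤ i) (h2 : i ≤ q)
    (hq : q ≤ π.length) (hmin : ∀ m, 1 ≤ m → m ≤ q → ent π i ≤ ent π m)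
    (hR : Blk (ent π i) (π.drop q)) :
    ∃ A w R, π = A ++ ent π i :: w ++ R ∧ (∀ c ∈ A, ent π i < c) ∧ (∀ c ∈ w, ent π i < c) ∧
      Blk (ent π i) R := by
  have key : ∀ k (hk : k < π.length), k < q → k ≠ i - 1 → ent π i < π[k] := by
    intro k hk hkq hki
    have e : ent π (k + 1) = π[k] := by simp [ent, hk]
    have a := hmin (k + 1) (by omega) (by omega)
    have b : ent π i ≠ ent π (k + 1) := by
      intro he
      have := ent_inj π hn i (k + 1) h1 (by omega) (by omega) (by omega) he
      omega
    omega
  refine ⟨π.take (i - 1), (π.take q).drop i, π.drop q, ?_, ?_, ?_, hR⟩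
  · conv_lhs => rw [← List.take_append_drop q π]
    congr 1
    conv_lhs => rw [← List.take_append_drop (i - 1) (π.take q)]
    rw [drop_ent (π.take q) i h1 (by simp; omega)]
    congr 1
    · rw [List.take_take]; congr 1; omega
    · congr 1
      have : i - 1 < q := by omega
      simp [ent, List.getElem?_take, this]
  · intro c hc
    obtain ⟨k, hk, rfl⟩ := List.getElem_of_mem hc
    simp at hk
    simp only [List.getElem_take]
    exact key k (by omega) (by omega) (by omega)
  · intro c hc
    obtain ⟨k, hk, rfl⟩ := List.getElem_of_mem hc
    simp at hk
    simp only [List.getElem_take, List.getElem_drop]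
    exact key _ (by omega) (by omega) (by omega)

/-- if `π_i = min(π_1,…,π_{𝔅(π)-1})` is small (`≤ ⌊(n-1)/2⌋`),
then the value `π_i` lies in the valley-region of `s_{123,132}(π)`. -/
theorem stmt5 (n : ℕ) (π : List ℕ) (hπ : IsPermOf n π) (i : ℕ)
    (h1 : 1 ≤ i) (h2 : i ≤ vBoundary π - 1)
    (hmin : ∀ m, 1 ≤ m → m ≤ vBoundary π - 1 → ent π i ≤ ent π m)
    (hsmall : ent π i ≤ (n - 1) / 2) :
    InValleyRegion (s132 π) (ent π i) := by
  have hn : π.Nodup := by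
    refine (List.Perm.nodup_iff hπ).2 (List.nodup_range.map ?_)
    intro a b h; simpa using h
  have hle := vB_le_length π
  obtain ⟨A, w, R, hd, hA, hw, hR⟩ : ∃ A w R, π = A ++ ent π i :: w ++ R ∧
      (∀ c ∈ A, ent π i < c) ∧ (∀ c ∈ w, ent π i < c) ∧ Blk (ent π i) R := by
    rcases vB_spec π with ⟨-, h⟩ | h
    · exact decomp π hn i (vBoundary π - 1) h1 h2 (by omega) hmin
        (blk_of_alt π hn _ _ i h.2 h1 (by omega))
    · rw [h] at hmin h2
      by_cases hl : ent π π.length < ent π i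
      · refine decomp π hn i (π.length - 1) h1 h2 (by omega) hmin ?_
        rw [drop_ent π π.length (by omega) le_rfl, List.drop_length]
        exact .one _ _ _ hl (.nil _)
      · refine decomp π hn i π.length h1 (by omega) le_rfl ?_ ?_
        · intro m hm1 hm2
          rcases Nat.eq_or_lt_of_le hm2 with rfl | hm
          · omega
          · exact hmin m hm1 (by omega)
        · rw [List.drop_length]; exact .nil _
  generalize ent π i = x at *
  subst hd
  cases A with
  | nil =>
    obtain ⟨F, hF⟩ := s_last x (w ++ R)
    simp only [List.nil_append, List.cons_append]
    rw [hF]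
    exact region_last F x
  | cons b A =>
    obtain ⟨F, R', hF, hB, he⟩ := s_struct b x A w R (fun c hc => hA c (by simp [hc]))
      (hA b (by simp)) hw hR
    rw [he]
    exact region_main b x F R' hB (hA b (by simp)) hF
end

section
/- For all positive integers i ≤ ⌊(n−1)/2⌋ and all π ∈ Sₙ, setting σ = s_{123,132}^{i+⌊(n−1)/2⌋}(π), the subsequence σ_{n−1}, σ_{n−3}, …, σ_{n−2i+1} equals the identity of length i; that is, σ_{n−2k+1} = k for all 1 ≤ k ≤ i. -/
open scoped Classical

/-- number of entries of `st` greater than `x` -/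
def cntG (x : ℕ) (st : List ℕ) : ℕ := (st.filter (fun y => decide (x < y))).length

def Av : List ℕ → Prop
  | [] => True
  | x :: st => cntG x st ≤ 1 ∧ Av st

def pops (x : ℕ) : List ℕ → List ℕ × List ℕ
  | [] => ([], [])
  | y :: st => if cntG x (y :: st) ≤ 1 then ([], y :: st)
      else (y :: (pops x st).1, (pops x st).2)

def run : List ℕ → List ℕ → List ℕ
  | [], st => st
  | x :: rest, st => (pops x st).1 ++ run rest (x :: (pops x st).2)

def stk : List ℕ → List ℕ → List ℕ
  | [], st => st
  | x :: rest, st => stk rest (x :: (pops x st).2)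

lemma cntG_cons (x y : ℕ) (st : List ℕ) :
    cntG x (y :: st) = (if x < y then 1 else 0) + cntG x st := by
  unfold cntG
  by_cases h : x < y <;> simp [h, Nat.add_comm]

lemma cntG_mono {x y : ℕ} (h : y ≤ x) (st : List ℕ) : cntG x st ≤ cntG y st := by
  induction st with
  | nil => simp [cntG]
  | cons a st ih => rw [cntG_cons, cntG_cons]; split_ifs <;> omega

lemma cntG_append (x : ℕ) (a b : List ℕ) : cntG x (a ++ b) = cntG x a + cntG x b := by
  simp [cntG]

lemma two_le_cntG (x : ℕ) (st : List ℕ) :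
    2 ≤ cntG x st ↔ ∃ b c, [b, c].Sublist st ∧ x < b ∧ x < c := by
  constructor
  · intro h
    unfold cntG at h
    match hf : st.filter (fun y => decide (x < y)), h with
    | b :: c :: r, _ =>
      have hb : b ∈ st.filter (fun y => decide (x < y)) := by simp [hf]
      have hc : c ∈ st.filter (fun y => decide (x < y)) := by simp [hf]
      refine ⟨b, c, ?_, by simpa using (List.mem_filter.1 hb).2,
        by simpa using (List.mem_filter.1 hc).2⟩
      have h1 : [b, c].Sublist (b :: c :: r) := by simp
      rw [← hf] at h1
      exact h1.trans List.filter_sublist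
  · rintro ⟨b, c, hs, hb, hc⟩
    have := (hs.filter (fun y => decide (x < y))).length_le
    simpa [cntG, hb, hc] using this

lemma not_av_iff (l : List ℕ) :
    ¬ Av l ↔ ∃ a b c, [a, b, c].Sublist l ∧ a < b ∧ a < c := by
  induction l with
  | nil => simp [Av]
  | cons x st ih =>
    constructor
    · intro h
      by_cases h2 : Av st
      · have : 2 ≤ cntG x st := by
          by_contra h3
          exact h ⟨by omega, h2⟩
        obtain ⟨b, c, hs, hb, hc⟩ := (two_le_cntG _ _).1 this
        exact ⟨x, b, c, hs.cons_cons x, hb, hc⟩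
      · obtain ⟨a, b, c, hs, hb, hc⟩ := ih.1 h2
        exact ⟨a, b, c, hs.cons x, hb, hc⟩
    · rintro ⟨a, b, c, hs, hb, hc⟩ ⟨h1, h2⟩
      rcases List.sublist_cons_iff.1 hs with h | ⟨r, hr, h⟩
      · exact ih.2 ⟨a, b, c, h, hb, hc⟩ h2
      · simp only [List.cons.injEq] at hr
        obtain ⟨rfl, rfl⟩ := hr
        have := (two_le_cntG a st).2 ⟨b, c, h, hb, hc⟩
        omega

lemma isoBool_123 (t : List ℕ) :
    (isoBool t [1, 2, 3] = true ∨ isoBool t [1, 3, 2] = true) ↔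
      ∃ a b c, t = [a, b, c] ∧ a < b ∧ a < c := by
  match t with
  | [] => simp [isoBool]
  | [a] => simp [isoBool]
  | [a, b] => simp [isoBool]
  | [a, b, c] =>
    simp [isoBool, List.range_succ]
    grind
  | a :: b :: c :: d :: r => simp [isoBool]

lemma cond_iff (l : List ℕ) :
    (([[1, 2, 3], [1, 3, 2]] : List (List ℕ)).all (fun p => !containsPat l p)) = true ↔ Av l := by
  have h := not_av_iff l
  rw [← not_iff_not, h]
  constructor
  · intro h1
    have : containsPat l [1,2,3] = true ∨ containsPat l [1,3,2] = true := by
      simp at h1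
      by_cases h2 : containsPat l [1,2,3] = true
      · exact Or.inl h2
      · exact Or.inr (h1 (by simpa using h2))
    have : ∃ t, t.Sublist l ∧ (isoBool t [1, 2, 3] = true ∨ isoBool t [1, 3, 2] = true) := by
      rcases this with h2 | h2 <;> (simp [containsPat] at h2; obtain ⟨t, h3, h4⟩ := h2)
      · exact ⟨t, h3, Or.inl h4⟩
      · exact ⟨t, h3, Or.inr h4⟩
    obtain ⟨t, ht, h4⟩ := this
    obtain ⟨a, b, c, rfl, h5⟩ := (isoBool_123 t).1 h4
    exact ⟨a, b, c, ht, h5⟩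
  · rintro ⟨a, b, c, hs, h5⟩
    rcases (isoBool_123 [a,b,c]).2 ⟨a, b, c, rfl, h5⟩ with h6 | h6
    · have : containsPat l [1,2,3] = true := by
        simp only [containsPat, List.any_eq_true, List.mem_sublists]; exact ⟨_, hs, h6⟩
      simp [this]
    · have : containsPat l [1,3,2] = true := by
        simp only [containsPat, List.any_eq_true, List.mem_sublists]; exact ⟨_, hs, h6⟩
      simp [this]

lemma sortRun_eq_aux (x : ℕ) (rest : List ℕ) :
    ∀ (st out : List ℕ), Av st →
      sortRun [[1, 2, 3], [1, 3, 2]] (x :: rest) st out =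
      sortRun [[1, 2, 3], [1, 3, 2]] rest (x :: (pops x st).2) (out ++ (pops x st).1) := by
  intro st
  induction st with
  | nil =>
    intro out h
    rw [sortRun, if_pos]
    · simp [pops]
    · rw [cond_iff]; simp [Av, cntG]
  | cons y st ih =>
    intro out h
    rw [sortRun]
    by_cases hc : cntG x (y :: st) ≤ 1
    · rw [if_pos ((cond_iff (x :: y :: st)).2 ⟨hc, h⟩)]
      simp [pops, hc]
    · rw [if_neg (fun hh => hc ((cond_iff (x :: y :: st)).1 hh).1)]
      rw [ih _ h.2]
      simp [pops, hc]

lemma pops_append (x : ℕ) (st : List ℕ) : (pops x st).1 ++ (pops x st).2 = st := by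
  induction st with
  | nil => simp [pops]
  | cons y st ih => unfold pops; split_ifs <;> simp [ih]

lemma pops_cnt (x : ℕ) (st : List ℕ) : cntG x (pops x st).2 ≤ 1 := by
  induction st with
  | nil => simp [pops, cntG]
  | cons y st ih => unfold pops; split_ifs with h <;> simp [ih, h]

lemma av_append_right (a b : List ℕ) (h : Av (a ++ b)) : Av b := by
  induction a with
  | nil => exact h
  | cons x a ih => exact ih h.2

lemma pops_av (x : ℕ) (st : List ℕ) (h : Av st) : Av (x :: (pops x st).2) := by
  refine ⟨pops_cnt x st, av_append_right (pops x st).1 _ ?_⟩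
  rw [pops_append]; exact h

lemma pops_gt (x : ℕ) (st : List ℕ) (h : Av st) : ∀ y ∈ (pops x st).1, x < y := by
  induction st with
  | nil => simp [pops]
  | cons y st ih =>
    unfold pops
    split_ifs with hc
    · simp
    · intro z hz
      simp only [List.mem_cons] at hz
      rcases hz with rfl | hz
      · by_contra hzx
        rw [cntG_cons, if_neg hzx] at hc
        have := cntG_mono (show z ≤ x by omega) st
        have := h.1
        omega
      · exact ih h.2 z hz

lemma pops_last (x f : ℕ) (st : List ℕ) (h : st.getLast? = some f) :
    (pops x st).2.getLast? = some f := by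
  induction st with
  | nil => simp at h
  | cons y st ih =>
    unfold pops
    split_ifs with hc
    · exact h
    · cases st with
      | nil =>
        exfalso; apply hc; rw [cntG_cons]; simp [cntG]; split_ifs <;> omega
      | cons z st => exact ih (by simpa [List.getLast?_cons_cons] using h)

lemma sortRun_eq (inp : List ℕ) : ∀ st out, Av st →
    sortRun [[1, 2, 3], [1, 3, 2]] inp st out = out ++ run inp st := by
  induction inp with
  | nil => intro st out _; simp [sortRun, run]
  | cons x rest ih =>
    intro st out h
    rw [sortRun_eq_aux _ _ _ _ h, ih _ _ (pops_av x st h)]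
    simp [run]

lemma s132_eq (l : List ℕ) : s132 l = run l [] := by
  unfold s132 sortT
  rw [sortRun_eq l [] [] trivial]; simp

lemma run_perm (inp : List ℕ) : ∀ st, (run inp st).Perm (inp ++ st) := by
  induction inp with
  | nil => intro st; simp [run]
  | cons x rest ih =>
    intro st
    have h1 := (ih (x :: (pops x st).2)).append_left (pops x st).1
    rw [run]
    refine h1.trans ?_
    conv_rhs => rw [← pops_append x st]
    rw [List.perm_iff_count]
    intro a
    simp [List.count_cons]
    omega

lemma run_length (inp st : List ℕ) : (run inp st).length = inp.length + st.length := by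
  simpa using (run_perm inp st).length_eq

lemma stk_spec (A : List ℕ) : ∀ st, ∃ O, ∀ B, run (A ++ B) st = O ++ run B (stk A st) := by
  induction A with
  | nil => intro st; exact ⟨[], fun B => by simp [stk]⟩
  | cons x A ih =>
    intro st
    obtain ⟨O, hO⟩ := ih (x :: (pops x st).2)
    exact ⟨(pops x st).1 ++ O, fun B => by simp [run, stk, hO]⟩

lemma stk_av (A : List ℕ) : ∀ st, Av st → Av (stk A st) := by
  induction A with
  | nil => intro st h; exact h
  | cons x A ih => intro st h; exact ih _ (pops_av x st h)

lemma stk_sub (A : List ℕ) : ∀ st, (stk A st).Sublist (A.reverse ++ st) := by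
  induction A with
  | nil => intro st; simp [stk]
  | cons x A ih =>
    intro st
    refine (ih (x :: (pops x st).2)).trans ?_
    simp only [List.reverse_cons, List.append_assoc, List.singleton_append]
    refine List.Sublist.append_left (List.Sublist.cons_cons _ ?_) _
    conv_rhs => rw [← pops_append x st]
    simp

lemma stk_last (f : ℕ) (A : List ℕ) : ∀ st, st.getLast? = some f →
    (stk A st).getLast? = some f := by
  induction A with
  | nil => intro st h; exact h
  | cons x A ih =>
    intro st h
    refine ih _ ?_
    rw [List.getLast?_cons, pops_last x f st h]; rfl

lemma stk_concat (A : List ℕ) (x : ℕ) : ∀ st, ∃ S, stk (A ++ [x]) st = x :: S := by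
  induction A with
  | nil => intro st; exact ⟨_, rfl⟩
  | cons y A ih => intro st; exact ih _

lemma pops_over (x : ℕ) (T : List ℕ) (hT : T ≠ []) (h : cntG x T ≤ 1) : ∀ U, 
    ∃ U', (pops x (U ++ T)).2 = U' ++ T := by
  intro U
  induction U with
  | nil =>
    cases T with
    | nil => exact absurd rfl hT
    | cons t T => exact ⟨[], by simp [pops, h]⟩
  | cons u U ih =>
    obtain ⟨U', h1⟩ := ih
    simp only [List.cons_append]
    unfold pops
    split_ifs
    · exact ⟨u :: U, rfl⟩
    · exact ⟨U', h1⟩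

lemma pops_through (x k : ℕ) (T : List ℕ) (h : 2 ≤ cntG x (k :: T)) : ∀ U, 
    ∃ P S, pops x (U ++ k :: T) = (U ++ k :: P, S) ∧ P ++ S = T := by
  intro U
  induction U with
  | nil =>
    refine ⟨(pops x T).1, (pops x T).2, ?_, pops_append x T⟩
    have : ¬ cntG x (k :: T) ≤ 1 := by omega
    simp [pops, this]
  | cons u U ih =>
    obtain ⟨P, S, h1, h2⟩ := ih
    refine ⟨P, S, ?_, h2⟩
    have : ¬ cntG x (u :: (U ++ k :: T)) ≤ 1 := by
      rw [cntG_cons, cntG_append]; omega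
    simp [pops, this, h1]

lemma phase3 (k : ℕ) (S1 : List ℕ) : ∀ B U, ∃ O,
    (run B (U ++ k :: S1) = O ++ k :: S1 ∧ ∀ y ∈ B, cntG y (k :: S1) ≤ 1) ∨
    ∃ B1 x B2 R, B = B1 ++ x :: B2 ∧ 2 ≤ cntG x (k :: S1) ∧
      (∀ y ∈ B1, cntG y (k :: S1) ≤ 1) ∧
      R.length = 1 + B2.length + S1.length ∧ run B (U ++ k :: S1) = O ++ k :: R := by
  intro B
  induction B with
  | nil => intro U; exact ⟨U, Or.inl ⟨rfl, by simp⟩⟩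
  | cons x B ih =>
    intro U
    by_cases h : cntG x (k :: S1) ≤ 1
    · obtain ⟨U', hU⟩ := pops_over x (k :: S1) (by simp) h U
      obtain ⟨O, hO⟩ := ih (x :: U')
      refine ⟨(pops x (U ++ k :: S1)).1 ++ O, ?_⟩
      rcases hO with ⟨h1, h2⟩ | ⟨B1, z, B2, R, h1, h2, h3, h4, h5⟩
      · left
        constructor
        · rw [run, hU]; simp only [List.cons_append] at h1; rw [h1]; simp
        · simpa [h] using h2
      · right
        refine ⟨x :: B1, z, B2, R, by simp [h1], h2, by simpa [h] using h3, h4, ?_⟩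
        rw [run, hU]; simp only [List.cons_append] at h5; rw [h5]; simp
    · obtain ⟨P, S, h1, h2⟩ := pops_through x k S1 (by omega) U
      refine ⟨U, Or.inr ⟨[], x, B, P ++ run B (x :: S), rfl, by omega, by simp, ?_, ?_⟩⟩
      · simp [run_length, ← h2]; omega
      · rw [run, h1]; simp

def aft (k : ℕ) (l : List ℕ) : ℕ := l.length - (l.idxOf k + 1)

lemma aft_split (k : ℕ) (u v : List ℕ) (h : (u ++ k :: v).Nodup) :
    aft k (u ++ k :: v) = v.length := by
  have hk : k ∉ u := by
    intro hk
    rw [List.nodup_append] at h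
    exact h.2.2 k hk k (by simp) rfl
  simp [aft, List.idxOf_append, hk]
  omega

/-- Combined description of the fate of `k`. -/
lemma fate (A B : List ℕ) (k : ℕ) (hnd : (A ++ k :: B).Nodup) :
    ∃ S1 : List ℕ, S1.Sublist A.reverse ∧ cntG k S1 ≤ 1 ∧
      (∀ f, A.head? = some f → S1.getLast? = some f) ∧
      (∀ A1 j, A = A1 ++ [j] → j < k → j ∈ S1) ∧
      ((aft k (s132 (A ++ k :: B)) = S1.length ∧ ∀ y ∈ B, cntG y (k :: S1) ≤ 1) ∨
       ∃ B1 x B2, B = B1 ++ x :: B2 ∧ 2 ≤ cntG x (k :: S1) ∧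
        (∀ y ∈ B1, cntG y (k :: S1) ≤ 1) ∧
        aft k (s132 (A ++ k :: B)) = 1 + B2.length + S1.length) := by
  have hnd' : (s132 (A ++ k :: B)).Nodup := by
    rw [s132_eq]
    exact (by simpa using run_perm (A ++ k :: B) [] : (run (A ++ k :: B) []).Perm _).nodup_iff.2 hnd
  obtain ⟨O, hO⟩ := stk_spec A []
  have hav : Av (stk A []) := stk_av A [] trivial
  have hsub := stk_sub A []
  rw [List.append_nil] at hsub
  refine ⟨(pops k (stk A [])).2, ?_, pops_cnt _ _, ?_, ?_, ?_⟩
  · refine List.Sublist.trans ?_ hsub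
    conv_rhs => rw [← pops_append k (stk A [])]
    simp
  · intro f hf
    apply pops_last
    cases A with
    | nil => simp at hf
    | cons a A =>
      simp only [List.head?_cons, Option.some.injEq] at hf
      subst hf
      exact stk_last a A _ (by simp [pops])
  · rintro A1 j rfl hj
    obtain ⟨S, hS⟩ := stk_concat A1 j []
    have h1 := pops_append k (stk (A1 ++ [j]) [])
    have h2 := pops_gt k _ hav
    have h3 : j ∈ (pops k (stk (A1 ++ [j]) [])).1 ++ (pops k (stk (A1 ++ [j]) [])).2 := by
      rw [h1, hS]; simp
    rcases List.mem_append.1 h3 with h | h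
    · have := h2 j h; omega
    · exact h
  · obtain ⟨O', h⟩ := phase3 k (pops k (stk A [])).2 B []
    have hrun : s132 (A ++ k :: B) = O ++ ((pops k (stk A [])).1 ++
        run B (k :: (pops k (stk A [])).2)) := by
      rw [s132_eq, hO, run]
    rw [hrun] at hnd' ⊢
    simp only [List.nil_append] at h
    rcases h with ⟨h1, h2⟩ | ⟨B1, x, B2, R, h1, h2, h3, h4, h5⟩
    · left
      refine ⟨?_, h2⟩
      rw [h1, ← List.append_assoc, ← List.append_assoc] at hnd' ⊢
      exact aft_split _ _ _ hnd'
    · right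
      refine ⟨B1, x, B2, h1, h2, h3, ?_⟩
      rw [h5, ← List.append_assoc, ← List.append_assoc] at hnd' ⊢
      rw [aft_split _ _ _ hnd', h4]

lemma split_mem {k : ℕ} {l : List ℕ} (h : k ∈ l) : ∃ A B, l = A ++ k :: B :=
  List.append_of_mem h

lemma stepU (l : List ℕ) (hnd : l.Nodup) (k : ℕ) (hk : k ∈ l) (hk1 : 1 ≤ k)
    (h0 : ∀ j ∈ l, 1 ≤ j)
    (hj : ∀ j ∈ l, j < k → aft j l ≤ 2 * j - 1) : aft k (s132 l) ≤ 2 * k - 1 := by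
  obtain ⟨A, B, rfl⟩ := split_mem hk
  obtain ⟨S1, hsub, hcnt, -, -, hc⟩ := fate A B k hnd
  have hkA : k ∉ A := by
    intro hk
    rw [List.nodup_append] at hnd
    exact hnd.2.2 k hk k (by simp) rfl
  -- the number of small entries of the stack
  have hlen : S1.length = cntG k S1 + (S1.filter (fun y => decide (y < k))).length := by
    have hkS : k ∉ S1 := fun h => hkA (by simpa using hsub.subset h)
    clear hsub hc hcnt
    induction S1 with
    | nil => simp [cntG]
    | cons a S ih =>
      simp only [List.mem_cons, not_or] at hkS
      rw [cntG_cons]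
      have := ih hkS.2
      by_cases h : k < a
      · have h' : ¬ a < k := by omega
        simp [h, h']; omega
      · have h' : a < k := by omega
        simp [h, h']; omega
  have hLs : (S1.filter (fun y => decide (y < k))).reverse.Sublist A := by
    have := (List.filter_sublist (p := fun y => decide (y < k)) (l := S1)).trans hsub
    simpa using this.reverse
  have hr : (S1.filter (fun y => decide (y < k))).length = 0 ∨
      (S1.filter (fun y => decide (y < k))).length + B.length + 1 + 1 ≤ 2 * k := by
    rcases hL : (S1.filter (fun y => decide (y < k))).reverse with _ | ⟨y, L'⟩
    · left; simpa using congrArg List.length hL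
    · right
      have hy : y ∈ (S1.filter (fun y => decide (y < k))).reverse := by rw [hL]; simp
      have hyk : y < k := by
        have := List.mem_reverse.1 hy
        simpa using (List.mem_filter.1 this).2
      have hll : (S1.filter (fun y => decide (y < k))).length = L'.length + 1 := by
        simpa using congrArg List.length hL
      rw [hL] at hLs
      obtain ⟨r1, r2, hA, hyr, hs⟩ := List.cons_sublist_iff.1 hLs
      obtain ⟨r3, r4, rfl⟩ := split_mem hyr
      have hyA : y ∈ A := by rw [hA]; simp
      have h1 := hj y (by simp [hyA]) hyk
      have e : A ++ k :: B = r3 ++ y :: (r4 ++ r2 ++ k :: B) := by rw [hA]; simp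
      rw [e] at hnd h1
      rw [aft_split _ _ _ hnd] at h1
      have := hs.length_le
      have := h0 y (by simp [hyA])
      simp at h1
      omega
  rcases hc with ⟨h1, h2⟩ | ⟨B1, x, B2, h1, h2, h3, h4⟩
  · rw [h1]; omega
  · rw [h4]
    have hxk : x < k := by
      by_contra hx
      rw [cntG_cons, if_neg (by omega)] at h2
      have := cntG_mono (show k ≤ x by omega) S1
      omega
    have hxl : x ∈ A ++ k :: B := by simp [h1]
    have h5 := hj x hxl hxk
    have h6 := h0 x hxl
    have e : A ++ k :: B = (A ++ k :: B1) ++ x :: B2 := by rw [h1]; simp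
    rw [e] at hnd h5
    rw [aft_split _ _ _ hnd] at h5
    have : B.length = B1.length + 1 + B2.length := by rw [h1]; simp; omega
    omega

/-- Lower bound: an entry `j < k` after `k`. -/
lemma lowB (A B : List ℕ) (k f : ℕ) (hnd : (A ++ k :: B).Nodup) (hf : A.head? = some f)
    (hfk : k < f) (j : ℕ) (hjk : j < k) (hjB : j ∈ B) :
    aft j (A ++ k :: B) + 2 ≤ aft k (s132 (A ++ k :: B)) ∧
    (∀ A1 i, A = A1 ++ [i] → i < k → aft j (A ++ k :: B) + 3 ≤ aft k (s132 (A ++ k :: B))) := by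
  obtain ⟨S1, hsub, hcnt, hlast, hpre, hc⟩ := fate A B k hnd
  have hl := hlast f hf
  have hfS : f ∈ S1 := List.mem_of_getLast? hl
  have hj2 : 2 ≤ cntG j (k :: S1) := by
    rw [cntG_cons, if_pos hjk]
    have : 0 < cntG j S1 := by
      unfold cntG
      apply List.length_pos_of_mem (a := f)
      simp [hfS]; omega
    omega
  have hS1 : 1 ≤ S1.length := List.length_pos_of_mem hfS
  rcases hc with ⟨h1, h2⟩ | ⟨B1, x, B2, h1, h2, h3, h4⟩
  · have := h2 j hjB; omega
  · rw [h4]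
    have hj1 : j ∉ B1 := fun h => by have := h3 j h; omega
    have key : aft j (A ++ k :: B) ≤ B2.length := by
      have hjx : j ∈ x :: B2 := by
        rw [h1] at hjB
        rcases List.mem_append.1 hjB with h | h
        · exact absurd h hj1
        · exact h
      obtain ⟨C1, C2, hC⟩ := split_mem hjx
      have e : A ++ k :: B = (A ++ k :: B1 ++ C1) ++ j :: C2 := by rw [h1, hC]; simp
      rw [e] at hnd ⊢
      rw [aft_split _ _ _ hnd]
      have := congrArg List.length hC
      simp at this
      omega
    refine ⟨by omega, ?_⟩
    intro A1 i hA hik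
    have hi := hpre A1 i hA hik
    have : 2 ≤ S1.length := by
      match S1, hfS, hi with
      | [a], h, h' => simp at h h'; omega
      | a :: b :: r, _, _ => simp
    omega

lemma lowA (A B : List ℕ) (k f : ℕ) (hnd : (A ++ k :: B).Nodup) (hf : A.head? = some f)
    (hfk : k < f) :
    1 ≤ aft k (s132 (A ++ k :: B)) ∧
    (∀ A1 i, A = A1 ++ [i] → i < k → 2 ≤ aft k (s132 (A ++ k :: B))) := by
  obtain ⟨S1, hsub, hcnt, hlast, hpre, hc⟩ := fate A B k hnd
  have hfS : f ∈ S1 := List.mem_of_getLast? (hlast f hf)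
  have hS1 : 1 ≤ S1.length := List.length_pos_of_mem hfS
  have hle : S1.length ≤ aft k (s132 (A ++ k :: B)) := by
    rcases hc with ⟨h1, h2⟩ | ⟨B1, x, B2, h1, h2, h3, h4⟩ <;> omega
  refine ⟨by omega, ?_⟩
  intro A1 i hA hik
  have hi := hpre A1 i hA hik
  have : 2 ≤ S1.length := by
    match S1, hfS, hi with
    | [a], h, h' => simp at h h'; omega
    | a :: b :: r, _, _ => simp
  omega

lemma aft_inj {l : List ℕ} {a b : ℕ} (ha : a ∈ l) (hb : b ∈ l) (h : aft a l = aft b l) :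
    a = b := by
  have h1 := List.idxOf_lt_length_iff.2 ha
  have h2 := List.idxOf_lt_length_iff.2 hb
  unfold aft at h
  exact (List.idxOf_inj ha).1 (by omega)

lemma aft_cases (A B : List ℕ) (k j : ℕ) (hnd : (A ++ k :: B).Nodup)
    (hj : j ∈ A ++ k :: B) (hjk : j < k) :
    (j ∈ B ∧ aft j (A ++ k :: B) < B.length) ∨
    (j ∈ A ∧ B.length + 1 ≤ aft j (A ++ k :: B) ∧
      (aft j (A ++ k :: B) ≤ B.length + 1 → ∃ A1, A = A1 ++ [j])) := by
  simp only [List.mem_append, List.mem_cons] at hj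
  rcases hj with hj | hj | hj
  · right
    refine ⟨hj, ?_⟩
    obtain ⟨C1, C2, rfl⟩ := split_mem hj
    have e : (C1 ++ j :: C2) ++ k :: B = C1 ++ j :: (C2 ++ k :: B) := by simp
    rw [e] at hnd ⊢
    rw [aft_split _ _ _ hnd]
    simp only [List.length_append, List.length_cons]
    refine ⟨by omega, fun h => ⟨C1, ?_⟩⟩
    have : C2 = [] := List.length_eq_zero_iff.1 (by omega)
    rw [this]
  · omega
  · left
    refine ⟨hj, ?_⟩
    obtain ⟨C1, C2, rfl⟩ := split_mem hj
    have e : A ++ k :: (C1 ++ j :: C2) = (A ++ k :: C1) ++ j :: C2 := by simp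
    rw [e] at hnd ⊢
    rw [aft_split _ _ _ hnd]
    simp; omega

lemma stepL (l : List ℕ) (hnd : l.Nodup) (m i : ℕ)
    (hmem : ∀ k, 1 ≤ k → k ≤ m → k ∈ l)
    (hU : ∀ k, 1 ≤ k → k ≤ m → aft k l ≤ 2 * k - 1)
    (hL : ∀ k, 1 ≤ k → k ≤ m → min (2 * k - 1) (2 * i) ≤ aft k l)
    (f : ℕ) (hf : l.head? = some f) (hfm : m < f) :
    ∀ k, 1 ≤ k → k ≤ m → min (2 * k - 1) (2 * (i + 1)) ≤ aft k (s132 l) := by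
  intro k hk1 hkm
  obtain ⟨A, B, rfl⟩ := split_mem (hmem k hk1 hkm)
  have hfA : A.head? = some f := by
    cases A with
    | nil => simp at hf; omega
    | cons a A => simpa using hf
  have hfk : k < f := by omega
  have hB : aft k (A ++ k :: B) = B.length := aft_split _ _ _ hnd
  have hA := lowA A B k f hnd hfA hfk
  have hLk := hL k hk1 hkm
  have hUk := hU k hk1 hkm
  rcases Nat.lt_or_ge k 2 with h | hk2
  · have := hA.1; omega
  -- compare with `k - 1`
  rcases aft_cases A B k (k-1) hnd (hmem (k-1) (by omega) (by omega)) (by omega) with h | h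
  · have h1 := (lowB A B k f hnd hfA hfk (k-1) (by omega) h.1).1
    have h2 := hL (k-1) (by omega) (by omega)
    omega
  · have h3 := hU (k-1) (by omega) (by omega)
    have hik : i + 2 ≤ k := by omega
    rcases aft_cases A B k (i+1) hnd (hmem (i+1) (by omega) (by omega)) (by omega) with h' | h'
    · have h1 := (lowB A B k f hnd hfA hfk (i+1) (by omega) h'.1).1
      have h2 := hL (i+1) (by omega) (by omega)
      omega
    · have h4 := hU (i+1) (by omega) (by omega)
      obtain ⟨A1, hA1⟩ := h'.2.2 (by omega)
      rcases Nat.eq_zero_or_pos i with rfl | hi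
      · have := hA.2 A1 _ hA1 (by omega)
        omega
      · have h5 := hU i hi (by omega)
        have h6 := hL i hi (by omega)
        rcases aft_cases A B k i hnd (hmem i (by omega) (by omega)) (by omega) with h7 | h7
        · have := (lowB A B k f hnd hfA hfk i (by omega) h7.1).2 A1 _ hA1 (by omega)
          omega
        · omega

lemma s132_perm (l : List ℕ) : (s132 l).Perm l := by
  rw [s132_eq]; simpa using run_perm l []

lemma iter_perm (t : ℕ) (l : List ℕ) : (s132^[t] l).Perm l := by
  induction t with
  | zero => exact List.Perm.refl _
  | succ t ih => rw [Function.iterate_succ_apply']; exact (s132_perm _).trans ih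

lemma iterU (l : List ℕ) (hnd : l.Nodup) (h0 : ∀ j ∈ l, 1 ≤ j) (t : ℕ) :
    ∀ k ∈ l, k ≤ t → aft k (s132^[t] l) ≤ 2 * k - 1 := by
  induction t with
  | zero => intro k hk hkt; have := h0 k hk; omega
  | succ t ih =>
    intro k hk hkt
    rw [Function.iterate_succ_apply']
    have hp := iter_perm t l
    refine stepU _ (hp.nodup_iff.2 hnd) k (hp.mem_iff.2 hk) (h0 k hk)
      (fun j hj => h0 j (hp.mem_iff.1 hj)) ?_
    intro j hj hjk
    exact ih j (hp.mem_iff.1 hj) (by omega)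

/-- for `1 ≤ i ≤ ⌊(n-1)/2⌋` and any `π ∈ Sₙ`, writing
`σ = s_{123,132}^{i+⌊(n-1)/2⌋}(π)`, we have `σ_{n-2k+1} = k` for `1 ≤ k ≤ i`. -/
theorem stmt8 (n i : ℕ) (h1 : 1 ≤ i) (h2 : i ≤ (n - 1) / 2)
    (π : List ℕ) (hπ : IsPermOf n π) :
    ∀ k, 1 ≤ k → k ≤ i →
      ent (s132^[i + (n - 1) / 2] π) (n + 1 - 2 * k) = k := by
  have hnd : π.Nodup := by
    refine hπ.nodup_iff.2 ?_
    exact List.nodup_range.map (fun a b h => by simpa using h)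
  have hmem : ∀ j, j ∈ π ↔ 1 ≤ j ∧ j ≤ n := by
    intro j
    rw [hπ.mem_iff]
    simp only [List.mem_map, List.mem_range]
    constructor
    · rintro ⟨a, ha, rfl⟩; omega
    · rintro ⟨h1, h2⟩; exact ⟨j - 1, by omega, by omega⟩
  have hlen : π.length = n := by simpa using hπ.length_eq
  have hU := iterU π hnd (fun j hj => ((hmem j).1 hj).1)
  have hL : ∀ i, ∀ k, 1 ≤ k → k ≤ (n - 1) / 2 →
      min (2 * k - 1) (2 * i) ≤ aft k (s132^[i + (n - 1) / 2] π) := by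
    intro i
    induction i with
    | zero => intro k _ _; simp
    | succ i ih =>
      have hp := iter_perm (i + (n - 1) / 2) π
      have hl : (s132^[i + (n - 1) / 2] π).length = n := by rw [hp.length_eq, hlen]
      rw [show i + 1 + (n - 1) / 2 = (i + (n - 1) / 2) + 1 by omega,
        Function.iterate_succ_apply']
      have hU' : ∀ k, 1 ≤ k → k ≤ (n - 1) / 2 →
          aft k (s132^[i + (n - 1) / 2] π) ≤ 2 * k - 1 := fun k hk1 hk2 =>
        hU _ k ((hmem k).2 ⟨hk1, by omega⟩) (by omega)
      generalize hσ : s132^[i + (n - 1) / 2] π = σ at *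
      match σ, hl with
      | [], hl => simp at hl; omega
      | f :: r, hl =>
        refine stepL _ (hp.nodup_iff.2 hnd) _ i
          (fun k hk1 hk2 => hp.mem_iff.2 ((hmem k).2 ⟨hk1, by omega⟩)) hU' ih f rfl ?_
        by_contra hf
        have hf1 := ((hmem f).1 (hp.mem_iff.1 (by simp))).1
        have h3 := hU' f hf1 (by omega)
        have : aft f (f :: r) = r.length := by simp [aft]
        simp at hl
        omega
  intro k hk1 hki
  have hp := iter_perm (i + (n - 1) / 2) π
  have hl : (s132^[i + (n - 1) / 2] π).length = n := by rw [hp.length_eq, hlen]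
  have hkm : k ∈ s132^[i + (n - 1) / 2] π := hp.mem_iff.2 ((hmem k).2 ⟨hk1, by omega⟩)
  have a1 := hL i k hk1 (by omega)
  have a2 := hU (i + (n - 1) / 2) k ((hmem k).2 ⟨hk1, by omega⟩) (by omega)
  have hx := List.idxOf_lt_length_iff.2 hkm
  unfold aft at a1 a2
  have hidx : n + 1 - 2 * k - 1 = (s132^[i + (n - 1) / 2] π).idxOf k := by omega
  unfold ent
  rw [hidx, List.getD_eq_getElem _ _ hx]
  exact List.getElem_idxOf hx
end
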